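/- Let b = i and let a = (2 + i − √3)/2 or a = (2 + i + √3)/2. Let u : ℕ → ℂ be a sequence with b + u(n) ≠ 0 for all n satisfying u(n+2)·(b + u(n)) = a + u(n+1) for all n. Then u is periodic with period 12: u(n+12) = u(n) for all n. (This is the case n = 3 of Theorem 2: the maps f_{α,β} with parameters in V₃ are periodic of period 12.) -/

import Mathlib

/-- One step of the recurrence `v₂ v₀ = c + v₁ + b v₀` for fractions `vⱼ = nⱼ / dⱼ`, where `H` is
the common factor that cancels. -/
lemma fraction_step {K : Type*} [Field K] {v₀ v₁ v₂ n₀ d₀ n₁ d₁ b c : K} (H n₂ d₂ : K)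
    (hH : H ≠ 0) (h₀ : v₀ * d₀ = n₀) (h₁ : v₁ * d₁ = n₁) (hr : v₂ * v₀ = c + v₁ + b * v₀)
    (hden : n₀ * d₁ = H * d₂) (hnum : d₀ * d₁ * c + b * n₀ * d₁ + n₁ * d₀ = H * n₂) :
    v₂ * d₂ = n₂ := by
  apply mul_left_cancel₀ hH
  linear_combination -v₂ * hden + hnum + d₀ * d₁ * hr - (v₂ * d₁ - b * d₁) * h₀ + d₀ * h₁

set_option maxHeartbeats 1000000 in
/-- If `z` is a primitive twelfth root of unity, a nowhere vanishing solution of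
`v (n + 2) * v n = 1 - z + v (n + 1) + z ^ 3 * v n` returns to its initial value after twelve
steps. -/
lemma eq_after_twelve_steps {K : Type*} [Field K] {z : K} (hz : z ^ 4 - z ^ 2 + 1 = 0)
    {v : ℕ → K} (hv : ∀ n, v n ≠ 0)
    (hr : ∀ n, v (n + 2) * v n = 1 - z + v (n + 1) + z ^ 3 * v n) : v 12 = v 0 := by
  have hz2 : z ^ 2 ≠ 0 := fun h => one_ne_zero (α := K) (by
    linear_combination hz - (z ^ 2 - 1) * h)
  have hz21 : z ^ 2 - 1 ≠ 0 := fun h => one_ne_zero (α := K) (by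
    linear_combination hz - z ^ 2 * h)
  have num_ne {n : ℕ} {p q : K} (h : v n * p = q) (hp : p ≠ 0) : q ≠ 0 :=
    h ▸ mul_ne_zero (hv n) hp
  obtain ⟨x, hx⟩ : ∃ x, x = v 0 := ⟨_, rfl⟩
  obtain ⟨y, hy⟩ : ∃ y, y = v 1 := ⟨_, rfl⟩
  have x0 : x ≠ 0 := hx ▸ hv 0
  have y0 : y ≠ 0 := hy ▸ hv 1
  have h0 : v 0 * 1 = x := by rw [hx, mul_one]
  have h1 : v 1 * 1 = y := by rw [hy, mul_one]
  obtain ⟨D1, hD1⟩ : ∃ p, p = y - z ^ 3 := ⟨_, rfl⟩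
  obtain ⟨D2, hD2⟩ : ∃ p, p = x - z ^ 3 := ⟨_, rfl⟩
  obtain ⟨D3, hD3⟩ : ∃ p, p = x - z ^ 3 * y - z := ⟨_, rfl⟩
  obtain ⟨D4, hD4⟩ : ∃ p, p = z ^ 2 - z - z * y - z ^ 3 * x * y := ⟨_, rfl⟩
  obtain ⟨D5, hD5⟩ : ∃ p, p = z ^ 2 - 1 - z * y - z ^ 3 * x := ⟨_, rfl⟩
  obtain ⟨D6, hD6⟩ : ∃ p, p = (-1 + z + z ^ 2 - z ^ 3) + (z ^ 2 - 1) * y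
    + (-1 + z ^ 2 - z ^ 3) * x - z * x * y := ⟨_, rfl⟩
  obtain ⟨N3, hN3⟩ : ∃ p, p = (-1 + z ^ 2 - z ^ 3) + (-z + z ^ 2 - z ^ 3) * y
    + (z ^ 2 - z ^ 3) * x + (1 - z) * x * y := ⟨_, rfl⟩
  obtain ⟨N4, hN4⟩ : ∃ p, p = (-2 + z + 2 * z ^ 2 - 2 * z ^ 3) + (-1 + z ^ 2 - z ^ 3) * y
    + (-1 - z + 3 * z ^ 2 - 2 * z ^ 3) * x + (-z + z ^ 2 - z ^ 3) * x * y
    + (1 - z) * x ^ 2 := ⟨_, rfl⟩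
  obtain ⟨N5, hN5⟩ : ∃ p, p = (-1 + z + z ^ 2 - z ^ 3) + (-3 + z + 3 * z ^ 2 - 2 * z ^ 3) * y
    + (-1 + z ^ 2 - z ^ 3) * y ^ 2 + (-1 + z ^ 2 - z ^ 3) * x
    + (-z + z ^ 2 - z ^ 3) * x * y := ⟨_, rfl⟩
  obtain ⟨N6, hN6⟩ : ∃ p, p = (-1 + z + z ^ 2 - z ^ 3) + (z ^ 2 - 1) * y
    + (-1 + z ^ 2 - z ^ 3) * x + (-1 + z ^ 2 - z ^ 3) * x * y := ⟨_, rfl⟩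
  obtain ⟨N2, hN2⟩ : ∃ p, p = (-z + z ^ 2 - z ^ 3) + (1 - z) * y + x := ⟨_, rfl⟩
  obtain ⟨F2, hF2⟩ : ∃ p, p = 1 - z + y + z ^ 3 * x := ⟨_, rfl⟩
  obtain ⟨F4, hF4⟩ : ∃ p, p = z ^ 3 - z ^ 2 - z ^ 2 * y := ⟨_, rfl⟩
  obtain ⟨F5, hF5⟩ : ∃ p, p = z ^ 3 - z ^ 2 - z ^ 2 * y + (z - z ^ 2) * x := ⟨_, rfl⟩
  have e3 : x * (1 - z) + z ^ 3 * y * x + F2 = -z ^ 2 * D6 := by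
    rw [hF2, hD6]
    linear_combination ((1 - z) + y + (1 - z) * x) * hz
  have e4 : x * y * (1 - z) + z ^ 3 * F2 * y - z ^ 2 * D6 = D5 * F4 := by
    rw [hF2, hD6, hD5, hF4]
    linear_combination (z ^ 2 * x + (1 - z + z ^ 2) * x * y) * hz
  have e5 : x * y * F2 * (1 - z) - z ^ 5 * D6 * F2 + D5 * F4 * x
      = -z ^ 2 * (z ^ 2 - 1) * D4 * F5 := by
    rw [hF2, hD6, hD5, hF4, hD4, hF5]
    linear_combination ((z ^ 2 - z ^ 3 + z ^ 4 - z ^ 5 - z ^ 6 + z ^ 7) * x + (1 - 2 * z + 3 * z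
      ^ 2 - z ^ 3 + z ^ 4 + z ^ 5 - 2 * z ^ 6) * x * y + (1 - z + z ^ 2 + z ^ 5) * x * y ^ 2 +
      (z ^ 5 - z ^ 6 + z ^ 7) * x ^ 2 + (z ^ 3 - z ^ 4 + 2 * z ^ 5) * x ^ 2 * y) * hz
  have e6 : y * F2 * D6 * (1 - z) + z ^ 3 * D5 * F4 * D6 + (z ^ 2 - 1) * D4 * F5 * y
      = F4 * D3 * N6 := by
    rw [hF2, hD6, hD5, hF4, hD4, hF5, hD3, hN6]
    linear_combination ((z ^ 3 - 2 * z ^ 4 + 2 * z ^ 6 - z ^ 7) + (-1 + 3 * z - 3 * z ^ 2 + 2 *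
      z ^ 3 + z ^ 4 - 5 * z ^ 5 + 3 * z ^ 6) * y + (-2 + 4 * z - 2 * z ^ 2 - z ^ 3 + 4 * z ^ 4 -
      3 * z ^ 5) * y ^ 2 + (-1 + z - z ^ 3 + z ^ 4) * y ^ 3 + (-z ^ 2 + 3 * z ^ 3 - 2 * z ^ 4 -
      z ^ 5 + 3 * z ^ 6 - 3 * z ^ 7 + z ^ 8) * x + (-1 + 2 * z - 2 * z ^ 2 + 5 * z ^ 4 - 5 * z ^
      5 + 4 * z ^ 6 - 2 * z ^ 7) * x * y + (-1 + 2 * z ^ 2 - 4 * z ^ 3 + 5 * z ^ 4 - 2 * z ^ 5 +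
      z ^ 6) * x * y ^ 2 + (-z + z ^ 2 - z ^ 3 + z ^ 4) * x * y ^ 3 + (-z ^ 2 + z ^ 3 - z ^ 5 +
      2 * z ^ 6 - 2 * z ^ 7 + z ^ 8) * x ^ 2 + (-2 * z ^ 2 + z ^ 4 - 2 * z ^ 5 + 2 * z ^ 6 - z ^
      7) * x ^ 2 * y + (-z ^ 2 - z ^ 5) * x ^ 2 * y ^ 2) * hz
  have e7 : F2 * D6 * D5 * (1 - z) + z ^ 3 * (z ^ 2 - 1) * D4 * F5 * D5 + D3 * N6 * F2
          = (z ^ 2 - 1) * F5 * D2 * N5 := by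
    rw [hF2, hD6, hD5, hD4, hF5, hD3, hN6, hD2, hN5]
    linear_combination ((1 - 2 * z + 3 * z ^ 3 - 4 * z ^ 4 + 2 * z ^ 5 + 2 * z ^ 6 - 3 * z ^ 7 +
      z ^ 8) + (2 - z - 5 * z ^ 2 + 8 * z ^ 3 - 7 * z ^ 4 - 2 * z ^ 5 + 10 * z ^ 6 - 5 * z ^ 7)
      * y + (1 + 2 * z - 5 * z ^ 2 + 5 * z ^ 3 - 3 * z ^ 4 - 6 * z ^ 5 + 7 * z ^ 6 - z ^ 7) * y
      ^ 2 + (z - z ^ 2 + z ^ 3 - 2 * z ^ 5 + z ^ 6) * y ^ 3 + (z - z ^ 2 + 3 * z ^ 3 - 5 * z ^ 4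
      - z ^ 5 + 5 * z ^ 6 - 3 * z ^ 7 + 2 * z ^ 8 - z ^ 9) * x + (-1 + 5 * z - 2 * z ^ 2 + 3 * z
      ^ 3 - z ^ 4 - 9 * z ^ 5 + 6 * z ^ 6 - 2 * z ^ 7 + 3 * z ^ 8 - z ^ 9) * x * y + (-1 + 3 * z
      + 3 * z ^ 2 - z ^ 3 + z ^ 4 - 4 * z ^ 5 + z ^ 6 - 2 * z ^ 7 + 2 * z ^ 8) * x * y ^ 2 + (2
      * z ^ 2 - z ^ 7) * x * y ^ 3 + (-1 + 3 * z ^ 2 - z ^ 3 - z ^ 4 + z ^ 5 + z ^ 6 - 2 * z ^ 7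
      + z ^ 8) * x ^ 2 + (-2 - 2 * z + 5 * z ^ 2 + z ^ 3 - 2 * z ^ 4 + 2 * z ^ 5 - 2 * z ^ 7 + z
      ^ 8 - z ^ 9 + z ^ 10) * x ^ 2 * y + (-1 - z + z ^ 2 + z ^ 3 - z ^ 4 + 2 * z ^ 5 + z ^ 6 -
      z ^ 7 - z ^ 9) * x ^ 2 * y ^ 2 + (-z + z ^ 2 - 2 * z ^ 4 + 2 * z ^ 5 - z ^ 6) * x ^ 3 +
      (-z ^ 2 + z ^ 3 - 2 * z ^ 4 + z ^ 5 + z ^ 8 - z ^ 9) * x ^ 3 * y) * hz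
  have e8 : D6 * D5 * D4 * (1 - z) + z ^ 3 * D3 * N6 * D4 + D2 * N5 * D6 = N6 * D1 * N4 := by
    rw [hD6, hD5, hD4, hD3, hN6, hD2, hN5, hD1, hN4]
    linear_combination ((-z + 3 * z ^ 2 - z ^ 3 - 3 * z ^ 4 + 2 * z ^ 5) + (-2 + z + 4 * z ^ 2 -
      2 * z ^ 3 - 2 * z ^ 6 + z ^ 7) * y + (-3 + z + 2 * z ^ 2 - 2 * z ^ 3 + 3 * z ^ 4 + z ^ 5 -
      2 * z ^ 6) * y ^ 2 + (-1 - z ^ 3 + z ^ 4 + z ^ 5) * y ^ 3 + (1 - 3 * z + 2 * z ^ 2 + 3 * z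
      ^ 3 - 4 * z ^ 4 + 2 * z ^ 5) * x + (1 - 5 * z + 2 * z ^ 2 + z ^ 3 - 2 * z ^ 4 + 4 * z ^ 5
      - 3 * z ^ 6 + z ^ 7) * x * y + (-3 * z + 2 * z ^ 2 - 6 * z ^ 3 + 4 * z ^ 5 - 3 * z ^ 6 + 2
      * z ^ 7 - z ^ 8) * x * y ^ 2 + (-z + z ^ 2 - 3 * z ^ 3 - z ^ 4 + z ^ 5 - z ^ 6 + z ^ 7) *
      x * y ^ 3 + (2 - 2 * z - 2 * z ^ 2 + 3 * z ^ 3 - z ^ 4) * x ^ 2 + (4 - 2 * z - 3 * z ^ 2 +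
      4 * z ^ 3 - 4 * z ^ 4 + z ^ 5) * x ^ 2 * y + (1 + z + z ^ 2 - z ^ 3 - 2 * z ^ 4 + z ^ 5 -
      2 * z ^ 6 + z ^ 7 - z ^ 8) * x ^ 2 * y ^ 2 + (z ^ 2 - z ^ 3 - z ^ 6 + z ^ 7 - z ^ 8) * x ^
      2 * y ^ 3 + (1 - z ^ 2 + z ^ 3) * x ^ 3 + (1 + z - z ^ 2 + z ^ 3 + z ^ 4 - z ^ 5 + z ^ 6)
      * x ^ 3 * y + (1 - z + z ^ 2 + z ^ 5) * x ^ 3 * y ^ 2) * hz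
  have e9 : D5 * D4 * D3 * (1 - z) + z ^ 3 * D2 * N5 * D3 + D1 * N4 * D5 = N5 * N3 := by
    rw [hD5, hD4, hD3, hD2, hN5, hD1, hN4, hN3]
    linear_combination ((-1 + z - 2 * z ^ 3 + 2 * z ^ 4 + z ^ 5 - z ^ 6) + (-1 - z + 2 * z ^ 2 -
      6 * z ^ 3 + 2 * z ^ 4 + 3 * z ^ 5 - 2 * z ^ 6 + z ^ 7 - z ^ 8) * y + (-z + 3 * z ^ 2 - 6 *
      z ^ 3 + z ^ 5 - 2 * z ^ 6 + 3 * z ^ 7 - 2 * z ^ 8) * y ^ 2 + (z ^ 2 - z ^ 3 - z ^ 6 + z ^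
      7 - z ^ 8) * y ^ 3 + (-1 + z - 4 * z ^ 3 + 2 * z ^ 4 - z ^ 6) * x + (2 - 2 * z + 3 * z ^ 2
      - 4 * z ^ 3 - 2 * z ^ 4 + 2 * z ^ 5 - 2 * z ^ 6 + z ^ 7 - z ^ 8) * x * y + (3 - 2 * z + 2
      * z ^ 2 + z ^ 3 - 3 * z ^ 4 + 3 * z ^ 5 - 2 * z ^ 6 + z ^ 7 - z ^ 8) * x * y ^ 2 + (1 - z
      + z ^ 2 + z ^ 5) * x * y ^ 3 + (z ^ 2 - z ^ 3 + 2 * z ^ 4 - z ^ 5) * x ^ 2 + (z ^ 3 + z ^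
      5) * x ^ 2 * y + (-z ^ 2 + z ^ 3 + z ^ 6) * x ^ 2 * y ^ 2 - z ^ 3 * x ^ 3 - z ^ 3 * x ^ 3
      * y) * hz
  have e10 : D4 * D3 * D2 * (1 - z) + z ^ 3 * D1 * N4 * D2 + N3 * D4 = N4 * N2 := by
    rw [hD4, hD3, hD2, hD1, hN4, hN3, hN2]
    linear_combination ((-z + 2 * z ^ 2 - 3 * z ^ 3 + z ^ 4 - z ^ 6 + 2 * z ^ 7 - 2 * z ^ 8) +
      (2 - 3 * z + 3 * z ^ 2 - 2 * z ^ 3 + z ^ 5 - z ^ 6 + z ^ 7 - z ^ 8) * y + (1 - z + z ^ 2 +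
      z ^ 5) * y ^ 2 + (2 - 2 * z + z ^ 2 - 3 * z ^ 4 + 4 * z ^ 5 - 3 * z ^ 6 + 3 * z ^ 7 - 2 *
      z ^ 8) * x + (2 - z - z ^ 2 + 3 * z ^ 3 - 4 * z ^ 4 + 4 * z ^ 5 - 2 * z ^ 6 + z ^ 7 - z ^
      8) * x * y + (-z ^ 2 + z ^ 3 + z ^ 6) * x * y ^ 2 + (1 + z - 2 * z ^ 2 + 4 * z ^ 3 - 4 * z
      ^ 4 + 3 * z ^ 5 - z ^ 6) * x ^ 2 + (-1 + 2 * z - 2 * z ^ 2 + 2 * z ^ 3 - z ^ 4 + z ^ 5) *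
      x ^ 2 * y - z ^ 3 * x ^ 2 * y ^ 2 + (-1 + z - z ^ 2 + z ^ 3) * x ^ 3) * hz
  have e11 : D3 * D2 * D1 * (1 - z) + z ^ 3 * N3 * D1 + N2 * D3 = N3 * (x + 1 - z) := by
    rw [hD3, hD2, hD1, hN3, hN2]
    linear_combination ((1 - z + z ^ 2 + z ^ 5) + (-z ^ 2 + z ^ 3 + z ^ 6) * y - z ^ 3 * y ^ 2 +
      (1 - 2 * z - z ^ 4 + z ^ 5) * x + (z - z ^ 2) * x * y + x ^ 2) * hz
  have e12 : D2 * D1 * (1 - z) + z ^ 3 * N2 + (x + 1 - z) * D2 = N2 * x := by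
    rw [hD2, hD1, hN2]
    linear_combination (-z ^ 3 + x) * hz
  have h2 : v 2 * x = F2 :=
    fraction_step 1 F2 x one_ne_zero h0 h1 (hr 0) (by ring) (by rw [hF2]; ring)
  have F20 := num_ne h2 x0
  have h3 : v 3 * (x * y) = -z ^ 2 * D6 :=
    fraction_step 1 _ _ one_ne_zero h1 h2 (hr 1) (by ring)
      (by linear_combination e3)
  have D60 := right_ne_zero_of_mul (num_ne h3 (mul_ne_zero x0 y0))
  have h4 : v 4 * (y * F2) = D5 * F4 :=
    fraction_step x _ _ x0 h2 h3 (hr 2) (by ring)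
      (by linear_combination x * e4)
  obtain ⟨D50, F40⟩ := mul_ne_zero_iff.mp (num_ne h4 (mul_ne_zero y0 F20))
  have h5 : v 5 * (F2 * D6) = (z ^ 2 - 1) * (D4 * F5) :=
    fraction_step (-z ^ 2 * y) _ _ (mul_ne_zero (neg_ne_zero.mpr hz2) y0) h3 h4 (hr 3)
      (by ring) (by linear_combination y * e5)
  obtain ⟨D40, F50⟩ := mul_ne_zero_iff.mp
    (right_ne_zero_of_mul (num_ne h5 (mul_ne_zero F20 D60)))
  have h6 : v 6 * (D6 * D5) = D3 * N6 :=
    fraction_step (F4 * F2) _ _ (mul_ne_zero F40 F20) h4 h5 (hr 4) (by ring)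
      (by linear_combination F2 * e6)
  obtain ⟨D30, N60⟩ := mul_ne_zero_iff.mp (num_ne h6 (mul_ne_zero D60 D50))
  have h7 : v 7 * (D5 * D4) = D2 * N5 :=
    fraction_step ((z ^ 2 - 1) * (F5 * D6)) _ _ (mul_ne_zero hz21 (mul_ne_zero F50 D60))
      h5 h6 (hr 5) (by ring) (by linear_combination D6 * e7)
  obtain ⟨D20, N50⟩ := mul_ne_zero_iff.mp (num_ne h7 (mul_ne_zero D50 D40))
  have h8 : v 8 * (D4 * D3) = D1 * N4 :=
    fraction_step (N6 * D5) _ _ (mul_ne_zero N60 D50) h6 h7 (hr 6) (by ring)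
      (by linear_combination D5 * e8)
  obtain ⟨D10, N40⟩ := mul_ne_zero_iff.mp (num_ne h8 (mul_ne_zero D40 D30))
  have h9 : v 9 * (D3 * D2) = N3 :=
    fraction_step (N5 * D4) _ _ (mul_ne_zero N50 D40) h7 h8 (hr 7) (by ring)
      (by linear_combination D4 * e9)
  have N30 := num_ne h9 (mul_ne_zero D30 D20)
  have h10 : v 10 * (D2 * D1) = N2 :=
    fraction_step (N4 * D3) _ _ (mul_ne_zero N40 D30) h8 h9 (hr 8) (by ring)
      (by linear_combination D3 * e10)
  have N20 := num_ne h10 (mul_ne_zero D20 D10)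
  have h11 : v 11 * D1 = x + 1 - z :=
    fraction_step (N3 * D2) _ _ (mul_ne_zero N30 D20) h9 h10 (hr 9) (by ring)
      (by linear_combination D2 * e11)
  have h12 : v 12 * 1 = x :=
    fraction_step (N2 * D1) _ _ (mul_ne_zero N20 D10) h10 h11 (hr 10) (by ring)
      (by linear_combination D1 * e12)
  rw [← hx, ← h12, mul_one]

/-- For `b = i` and `a = (2 + i ± √3)/2`: a complex sequence with `b + u(n) ≠ 0` for all
`n` satisfying `u(n+2)·(b + u(n)) = a + u(n+1)` is periodic of period 12 (parameters in
`V₃`). -/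
theorem stmt18 (a : ℂ)
    (ha : a = (2 + Complex.I - (Real.sqrt 3 : ℂ)) / 2 ∨
          a = (2 + Complex.I + (Real.sqrt 3 : ℂ)) / 2)
    (u : ℕ → ℂ) (h0 : ∀ n, Complex.I + u n ≠ 0)
    (hrec : ∀ n, u (n + 2) * (Complex.I + u n) = a + u (n + 1)) :
    ∀ n, u (n + 12) = u n := by
  intro n
  have hI : Complex.I ^ 2 = -1 := Complex.I_sq
  have hs : (Real.sqrt 3 : ℂ) ^ 2 = 3 := by
    rw [← Complex.ofReal_pow, Real.sq_sqrt (by norm_num)]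
    norm_num
  obtain ⟨z, hz⟩ : ∃ z, z = 1 + Complex.I - a := ⟨_, rfl⟩
  have hz2 : z ^ 2 = Complex.I * z + 1 := by
    rcases ha with rfl | rfl <;> subst hz <;> linear_combination hs / 4 - hI / 4
  have hz3 : z ^ 3 = Complex.I := by
    linear_combination (z + Complex.I) * hz2 + z * hI
  have h4 : z ^ 4 - z ^ 2 + 1 = 0 := by
    linear_combination z * hz3 - hz2
  have h := eq_after_twelve_steps h4 (v := fun k => Complex.I + u (n + k))
    (fun k => h0 (n + k)) (fun k => by
      simp only [hz3, ← add_assoc]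
      linear_combination hrec (n + k) + hz)
  simpa using h
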